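/- (Proposition on general parametric families, part (i).) Let p ∈ [1,∞) and let M = {P_θ : θ ∈ Θ} be a family of Borel probability measures on ℝ^d with finite p-th moments, indexed by a metric space (Θ, ρ), such that (a) the map θ ↦ P_θ is one-to-one and continuous from (Θ, ρ) to the set of such measures equipped with the p-Wasserstein distance, and (b) the measurable estimator θ̂_n = θ_n(X₁,…,Xₙ) is weakly consistent locally uniformly in θ: for every ε > 0 and every compact K ⊆ Θ, lim_{n→∞} sup_{θ∈K} P_θⁿ[ρ(θ̂_n, θ) > ε] = 0. Let T_{M,n} = W_p^p(P̂_n, P_{θ̂_n}), with P̂_n the empirical distribution of X₁,…,Xₙ. Then T_{M,n} → 0 in P_θⁿ-probability locally uniformly in θ: for every ε > 0 and every compact K ⊆ Θ, lim_{n→∞} sup_{θ∈K} P_θⁿ[T_{M,n} > ε] = 0. -/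

import Mathlib

open MeasureTheory ENNReal Filter Topology

noncomputable section

/-- `ℝ^d` as Euclidean space. -/
abbrev Euc (d : ℕ) : Type := EuclideanSpace ℝ (Fin d)

/-- The set of couplings of two Borel probability measures: probability measures on the
product space whose first marginal is `P` and second marginal is `Q`. -/
def couplings {E : Type*} [MeasurableSpace E] (P Q : Measure E) : Set (Measure (E × E)) :=
  {γ | IsProbabilityMeasure γ ∧ γ.map Prod.fst = P ∧ γ.map Prod.snd = Q}

/-- `W_p^p(P,Q)`: the `p`-th power of the `p`-Wasserstein distance,
`inf_{γ ∈ Γ(P,Q)} ∫ ‖x - y‖^p dγ(x,y)`, as an extended nonnegative real. -/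
def WpPow {E : Type*} [MeasurableSpace E] [NormedAddCommGroup E] (p : ℝ) (P Q : Measure E) :
    ℝ≥0∞ :=
  ⨅ γ ∈ couplings P Q, ∫⁻ z, ENNReal.ofReal (‖z.1 - z.2‖ ^ p) ∂γ

/-- The `p`-Wasserstein distance `W_p(P,Q)`. -/
def Wp {E : Type*} [MeasurableSpace E] [NormedAddCommGroup E] (p : ℝ) (P Q : Measure E) :
    ℝ≥0∞ :=
  WpPow p P Q ^ (1 / p)

/-- Empirical distribution `n⁻¹ ∑ᵢ δ_{x i}` of `n` points. -/
def empDist {E : Type*} [MeasurableSpace E] {n : ℕ} (x : Fin n → E) : Measure E :=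
  (n : ℝ≥0∞)⁻¹ • ∑ i, Measure.dirac (x i)

/-- The `n`-fold product measure `P^n` on `(ℝ^d)^n`. -/
def prodn {E : Type*} [MeasurableSpace E] (P : Measure E) (n : ℕ) : Measure (Fin n → E) :=
  Measure.pi fun _ => P

/-- `P` has a finite moment of order `p`. -/
def HasFinMom {E : Type*} [MeasurableSpace E] [NormedAddCommGroup E] (p : ℝ) (P : Measure E) :
    Prop :=
  ∫⁻ x, ENNReal.ofReal (‖x‖ ^ p) ∂P ≠ ∞

/-- the transport cost -/
def tcost {d : ℕ} (p : ℝ) (x y : Euc d) : ℝ≥0∞ := ENNReal.ofReal (‖x - y‖ ^ p)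

lemma tcost_meas {d : ℕ} (p : ℝ) : Measurable (fun z : Euc d × Euc d => tcost p z.1 z.2) := by
  unfold tcost
  fun_prop

lemma tcost_comm {d : ℕ} (p : ℝ) (x y : Euc d) : tcost p x y = tcost p y x := by
  unfold tcost
  rw [norm_sub_rev]

lemma tcost_tri {d : ℕ} {p : ℝ} (hp : 1 ≤ p) (x y z : Euc d) :
    tcost p x z ≤ ENNReal.ofReal (2 ^ (p - 1)) * (tcost p x y + tcost p y z) := by
  unfold tcost
  rw [← ENNReal.ofReal_add (by positivity) (by positivity), ← ENNReal.ofReal_mul (by positivity)]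
  apply ENNReal.ofReal_le_ofReal
  have h1 : ‖x - z‖ ≤ ‖x - y‖ + ‖y - z‖ := norm_sub_le_norm_sub_add_norm_sub x y z
  have h2 : ‖x - z‖ ^ p ≤ (‖x - y‖ + ‖y - z‖) ^ p :=
    Real.rpow_le_rpow (norm_nonneg _) h1 (by linarith)
  refine h2.trans ?_
  have := NNReal.rpow_add_le_mul_rpow_add_rpow ‖x - y‖₊ ‖y - z‖₊ hp
  exact_mod_cast this

lemma wp_le {d : ℕ} (p : ℝ) {P Q : Measure (Euc d)} {γ : Measure (Euc d × Euc d)}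
    (h : γ ∈ couplings P Q) : WpPow p P Q ≤ ∫⁻ z, tcost p z.1 z.2 ∂γ :=
  iInf₂_le γ h

lemma coupling_swap {d : ℕ} {P Q : Measure (Euc d)} {γ : Measure (Euc d × Euc d)}
    (h : γ ∈ couplings P Q) : γ.map Prod.swap ∈ couplings Q P := by
  obtain ⟨h1, h2, h3⟩ := h
  refine ⟨Measure.isProbabilityMeasure_map (by fun_prop), ?_, ?_⟩
  · rw [Measure.map_map (by fun_prop) (by fun_prop)]
    exact h3
  · rw [Measure.map_map (by fun_prop) (by fun_prop)]
    exact h2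

lemma lintegral_swap {d : ℕ} (p : ℝ) (γ : Measure (Euc d × Euc d)) :
    ∫⁻ z, tcost p z.1 z.2 ∂(γ.map Prod.swap) = ∫⁻ z, tcost p z.1 z.2 ∂γ := by
  rw [lintegral_map (tcost_meas p) (by fun_prop)]
  exact lintegral_congr fun z => tcost_comm _ _ _

lemma wp_comm_le {d : ℕ} (p : ℝ) (P Q : Measure (Euc d)) : WpPow p P Q ≤ WpPow p Q P := by
  refine le_iInf₂ fun γ hγ => ?_
  exact (wp_le p (coupling_swap hγ)).trans (lintegral_swap p γ).le

lemma gluing {d : ℕ} {Q P R : Measure (Euc d)}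
    {γ1 γ2 : Measure (Euc d × Euc d)} (h1 : γ1 ∈ couplings Q P) (h2 : γ2 ∈ couplings Q R) :
    ∃ ρ : Measure (Euc d × (Euc d × Euc d)),
      ρ.map (fun z => (z.1, z.2.1)) = γ1 ∧ ρ.map (fun z => (z.1, z.2.2)) = γ2 := by
  obtain ⟨i1, a1, b1⟩ := h1
  obtain ⟨i2, a2, b2⟩ := h2
  have iQ : IsProbabilityMeasure Q := a1 ▸ Measure.isProbabilityMeasure_map (by fun_prop)
  have e1 : Q.compProd γ1.condKernel = γ1 := by
    have := γ1.disintegrate γ1.condKernel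
    rwa [Measure.fst, a1] at this
  have e2 : Q.compProd γ2.condKernel = γ2 := by
    have := γ2.disintegrate γ2.condKernel
    rwa [Measure.fst, a2] at this
  refine ⟨Q.compProd (γ1.condKernel.prod γ2.condKernel), ?_, ?_⟩
  · have := Measure.compProd_map (μ := Q) (κ := γ1.condKernel.prod γ2.condKernel)
      (measurable_fst : Measurable (Prod.fst : Euc d × Euc d → Euc d))
    rw [← ProbabilityTheory.Kernel.fst_eq, ProbabilityTheory.Kernel.fst_prod, e1] at this
    exact this.symm
  · have := Measure.compProd_map (μ := Q) (κ := γ1.condKernel.prod γ2.condKernel)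
      (measurable_snd : Measurable (Prod.snd : Euc d × Euc d → Euc d))
    rw [← ProbabilityTheory.Kernel.snd_eq, ProbabilityTheory.Kernel.snd_prod, e2] at this
    exact this.symm

lemma wp_tri_aux {d : ℕ} {p : ℝ} (hp : 1 ≤ p) {P Q R : Measure (Euc d)}
    {γ1 γ2 : Measure (Euc d × Euc d)} (h1 : γ1 ∈ couplings P Q) (h2 : γ2 ∈ couplings Q R) :
    WpPow p P R ≤ ENNReal.ofReal (2 ^ (p - 1)) *
      (∫⁻ z, tcost p z.1 z.2 ∂γ1 + ∫⁻ z, tcost p z.1 z.2 ∂γ2) := by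
  obtain ⟨ρ, r1, r2⟩ := gluing (coupling_swap h1) h2
  have i2 := h2.1
  have s1 := coupling_swap h1
  have m : ∀ f : Euc d × (Euc d × Euc d) → Euc d × Euc d, Measurable f → 
    ∫⁻ z, tcost p z.1 z.2 ∂(ρ.map f) = ∫⁻ z, tcost p (f z).1 (f z).2 ∂ρ := fun f hf =>
      lintegral_map (tcost_meas p) hf
  have mm : ∀ f : Euc d × (Euc d × Euc d) → Euc d × Euc d, Measurable f → 
    Measurable (fun z => tcost p (f z).1 (f z).2) := fun f hf => (tcost_meas p).comp hf
  have iρ : IsProbabilityMeasure ρ := by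
    have : IsProbabilityMeasure (ρ.map (fun z => (z.1, z.2.2))) := r2 ▸ i2
    exact Measure.isProbabilityMeasure_of_map (fun z => (z.1, z.2.2))
  have hc : ρ.map Prod.snd ∈ couplings P R := by
    refine ⟨Measure.isProbabilityMeasure_map (by fun_prop), ?_, ?_⟩
    · rw [← s1.2.2, ← r1, Measure.map_map (by fun_prop) (by fun_prop),
        Measure.map_map (by fun_prop) (by fun_prop)]
      rfl
    · rw [← h2.2.2, ← r2, Measure.map_map (by fun_prop) (by fun_prop),
        Measure.map_map (by fun_prop) (by fun_prop)]
      rfl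
  refine (wp_le p hc).trans ?_
  rw [← lintegral_swap p γ1, ← r1, ← r2, m _ (by fun_prop), m _ (by fun_prop), m _ (by fun_prop),
    ← lintegral_add_left (mm (fun z => (z.1, z.2.1)) (by fun_prop)),
    ← lintegral_const_mul]
  · refine lintegral_mono fun z => ?_
    have := tcost_tri hp z.2.1 z.1 z.2.2
    rw [tcost_comm p z.2.1 z.1] at this
    exact this
  · exact (mm (fun z => (z.1, z.2.1)) (by fun_prop)).add (mm (fun z => (z.1, z.2.2)) (by fun_prop))

lemma wp_lt {d : ℕ} {p : ℝ} {P Q : Measure (Euc d)} {b : ℝ≥0∞} (h : WpPow p P Q < b) :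
    ∃ γ ∈ couplings P Q, ∫⁻ z, tcost p z.1 z.2 ∂γ < b := by
  unfold WpPow at h
  simp only [iInf_lt_iff] at h
  obtain ⟨γ, h1, h2⟩ := h
  exact ⟨γ, h1, h2⟩

lemma wp_tri {d : ℕ} {p : ℝ} (hp : 1 ≤ p) (P Q R : Measure (Euc d)) :
    WpPow p P R ≤ ENNReal.ofReal (2 ^ (p - 1)) * (WpPow p P Q + WpPow p Q R) := by
  have hC : ENNReal.ofReal (2 ^ (p - 1)) ≠ 0 := by
    simp only [ne_eq, ENNReal.ofReal_eq_zero, not_le]; positivity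
  rw [mul_comm, ← ENNReal.div_le_iff_le_mul (Or.inl hC) (Or.inl ENNReal.ofReal_ne_top)]
  refine le_of_forall_gt fun b hb => ?_
  obtain ⟨b1, b2, h1, h2, h3⟩ : ∃ b1 b2, WpPow p P Q < b1 ∧ WpPow p Q R < b2 ∧ b1 + b2 < b := by
    obtain ⟨e, he, hb'⟩ := ENNReal.lt_iff_exists_add_pos_lt.1 hb
    have t : WpPow p P Q + WpPow p Q R ≠ ∞ := (lt_top_of_lt hb).ne
    have he2 : (e / 2 : NNReal) ≠ 0 := by positivity
    have he3 : ((e / 2 : NNReal) : ℝ≥0∞) ≠ 0 := by exact_mod_cast he2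
    refine ⟨WpPow p P Q + (e / 2 : NNReal), WpPow p Q R + (e / 2 : NNReal),
      ENNReal.lt_add_right (fun h => t (by simp [h])) he3,
      ENNReal.lt_add_right (fun h => t (by simp [h])) he3, ?_⟩
    have : ((e / 2 : NNReal) : ℝ≥0∞) + (e / 2 : NNReal) = e := by
      rw [← ENNReal.coe_add, add_halves]
    rw [add_add_add_comm, this]
    exact hb'
  obtain ⟨γ1, g1, c1⟩ := wp_lt h1
  obtain ⟨γ2, g2, c2⟩ := wp_lt h2
  refine lt_of_le_of_lt ?_ ((ENNReal.add_lt_add c1 c2).trans h3)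
  rw [ENNReal.div_le_iff_le_mul (Or.inl hC) (Or.inl ENNReal.ofReal_ne_top), mul_comm]
  exact wp_tri_aux hp g1 g2

lemma wp_map_le {d : ℕ} (p : ℝ) (P : Measure (Euc d)) [IsProbabilityMeasure P]
    (T : Euc d → Euc d) (hT : Measurable T) :
    WpPow p P (P.map T) ≤ ∫⁻ x, tcost p x (T x) ∂P := by
  have hc : P.map (fun x => (x, T x)) ∈ couplings P (P.map T) := by
    refine ⟨Measure.isProbabilityMeasure_map (by fun_prop), ?_, ?_⟩
    · rw [Measure.map_map (by fun_prop) (by fun_prop)]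
      exact Measure.map_id
    · rw [Measure.map_map (by fun_prop) (by fun_prop)]
      rfl
  refine (wp_le p hc).trans ?_
  rw [lintegral_map (tcost_meas p) (by fun_prop)]

/-- discrete measure with weights `a` on `S` -/
def discM {d : ℕ} (S : Finset (Euc d)) (a : Euc d → ℝ≥0∞) : Measure (Euc d) :=
  ∑ y ∈ S, a y • Measure.dirac y

lemma discM_univ {d : ℕ} (S : Finset (Euc d)) (a : Euc d → ℝ≥0∞) :
    discM S a Set.univ = ∑ y ∈ S, a y := by
  simp [discM, Measure.finsetSum_apply]

lemma lintegral_discM {d : ℕ} (S : Finset (Euc d)) (a f : Euc d → ℝ≥0∞) :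
    ∫⁻ x, f x ∂(discM S a) = ∑ y ∈ S, a y * f y := by
  simp [discM, lintegral_finsetSum_measure, lintegral_smul_measure, lintegral_dirac]

lemma discM_add {d : ℕ} (S : Finset (Euc d)) (a b : Euc d → ℝ≥0∞) :
    discM S (fun y => a y + b y) = discM S a + discM S b := by
  simp [discM, add_smul, Finset.sum_add_distrib]

lemma wp_disc {d : ℕ} {p : ℝ} (hp : 1 ≤ p) (S : Finset (Euc d)) (a b : Euc d → ℝ≥0∞)
    (ha : ∑ y ∈ S, a y = 1) (hb : ∑ y ∈ S, b y = 1) (D : ℝ≥0∞)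
    (hD : ∀ y ∈ S, ∀ z ∈ S, tcost p y z ≤ D) :
    WpPow p (discM S a) (discM S b) ≤ D * ∑ y ∈ S, (a y - b y) := by
  set m : Measure (Euc d) := discM S (fun y => min (a y) (b y)) with hm
  set u : Measure (Euc d) := discM S (fun y => a y - b y) with hu
  set v : Measure (Euc d) := discM S (fun y => b y - a y) with hv
  set s : ℝ≥0∞ := ∑ y ∈ S, (a y - b y) with hs
  have eu : discM S a = m + u := by
    rw [hm, hu, ← discM_add]
    congr 1; ext y
    rcases le_total (a y) (b y) with h | h
    · simp [h, tsub_eq_zero_of_le h]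
    · simp [h, add_tsub_cancel_of_le h]
  have ev : discM S b = m + v := by
    rw [hm, hv, ← discM_add]
    congr 1; ext y
    rcases le_total (a y) (b y) with h | h
    · simp [h, add_tsub_cancel_of_le h]
    · simp [h, tsub_eq_zero_of_le h]
  have u1 : u Set.univ = s := discM_univ _ _
  have A1 : m Set.univ + u Set.univ = 1 := by
    rw [← ha, ← discM_univ S a, eu]; rfl
  have A2 : m Set.univ + v Set.univ = 1 := by
    rw [← hb, ← discM_univ S b, ev]; rfl
  have mt : m Set.univ ≠ ∞ := fun h => by simp [h] at A1
  have v1 : v Set.univ = s := by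
    rw [← u1]
    exact (ENNReal.add_right_inj mt).1 (A2.trans A1.symm)
  have st : s ≠ ∞ := fun h => by simp [u1, h] at A1
  have iu : IsFiniteMeasure u := ⟨by rw [u1]; exact st.lt_top⟩
  have iv : IsFiniteMeasure v := ⟨by rw [v1]; exact st.lt_top⟩
  have key : ∀ w : Measure (Euc d), w Set.univ = s → s⁻¹ • s • w = w := by
    intro w hw
    by_cases h0 : s = 0
    · have : w = 0 := by rw [← Measure.measure_univ_eq_zero, hw, h0]
      simp [this]
    · rw [smul_smul, ENNReal.inv_mul_cancel h0 st, one_smul]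
  set γ : Measure (Euc d × Euc d) := m.map (fun x => (x, x)) + s⁻¹ • u.prod v with hγ
  have f1 : γ.map Prod.fst = discM S a := by
    rw [hγ, Measure.map_add _ _ (by fun_prop), Measure.map_map (by fun_prop) (by fun_prop),
      Measure.map_smul, Measure.map_fst_prod, v1, key u u1, eu]
    congr 1
    exact Measure.map_id
  have f2 : γ.map Prod.snd = discM S b := by
    rw [hγ, Measure.map_add _ _ (by fun_prop), Measure.map_map (by fun_prop) (by fun_prop),
      Measure.map_smul, Measure.map_snd_prod, u1, key v v1, ev]
    congr 1
    exact Measure.map_id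
  have hc : γ ∈ couplings (discM S a) (discM S b) := by
    refine ⟨⟨?_⟩, f1, f2⟩
    rw [← ha, ← discM_univ, ← f1, Measure.map_apply (by fun_prop) MeasurableSet.univ]
    simp
  refine (wp_le p hc).trans ?_
  rw [hγ, lintegral_add_measure, lintegral_map (tcost_meas p) (by fun_prop),
    lintegral_smul_measure, lintegral_prod _ (tcost_meas p).aemeasurable]
  have z0 : ∀ x : Euc d, tcost p x x = 0 := by
    intro x
    have : p ≠ 0 := by linarith
    simp [tcost, Real.zero_rpow this]
  simp only [z0, lintegral_zero, zero_add]
  have c : ∫⁻ x, ∫⁻ y, tcost p x y ∂v ∂u ≤ D * s * s := by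
    rw [hu, lintegral_discM]
    rw [mul_comm, hs, Finset.sum_mul]
    refine Finset.sum_le_sum fun y hy => ?_
    gcongr
    rw [hv, lintegral_discM, ← hs, ← v1, hv, discM_univ, mul_comm, Finset.sum_mul]
    refine Finset.sum_le_sum fun z hz => ?_
    gcongr
    exact hD y hy z hz
  by_cases h0 : s = 0
  · simp only [h0, mul_zero, nonpos_iff_eq_zero] at c ⊢
    simp [c]
  · calc s⁻¹ * ∫⁻ x, ∫⁻ y, tcost p x y ∂v ∂u ≤ s⁻¹ * (D * s * s) := by gcongr
      _ = D * s := by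
        rw [mul_comm, mul_assoc, ENNReal.mul_inv_cancel h0 st, mul_one]

lemma map_simple {d : ℕ} (P : Measure (Euc d)) (T : SimpleFunc (Euc d) (Euc d)) :
    P.map T = discM T.range (fun y => P (T ⁻¹' {y})) := by
  ext A hA
  have h1 : P.map T A = ∫⁻ y, A.indicator 1 y ∂(P.map T) := by
    rw [lintegral_indicator_one hA]
  have h2 : discM T.range (fun y => P (T ⁻¹' {y})) A
      = ∫⁻ y, A.indicator 1 y ∂(discM T.range (fun y => P (T ⁻¹' {y}))) := by
    rw [lintegral_indicator_one hA]
  rw [h1, h2, lintegral_discM, lintegral_map (measurable_one.indicator hA) T.measurable]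
  have := SimpleFunc.map_lintegral (μ := P) (A.indicator (1 : Euc d → ℝ≥0∞)) T
  rw [← SimpleFunc.lintegral_eq_lintegral] at this
  simp only [mul_comm (P _)]
  exact this

lemma lintegral_emp {d n : ℕ} (x : Fin n → Euc d) (f : Euc d → ℝ≥0∞) :
    ∫⁻ y, f y ∂(empDist x) = (n : ℝ≥0∞)⁻¹ * ∑ i, f (x i) := by
  simp [empDist, lintegral_smul_measure, lintegral_finsetSum_measure, lintegral_dirac]

lemma emp_prob {d n : ℕ} (hn : n ≠ 0) (x : Fin n → Euc d) : IsProbabilityMeasure (empDist x) := by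
  constructor
  have := lintegral_emp x 1
  simp only [Pi.one_apply, lintegral_one] at this
  rw [this]
  simp only [Finset.sum_const, Finset.card_univ, Fintype.card_fin, nsmul_eq_mul, mul_one]
  exact ENNReal.inv_mul_cancel (by exact_mod_cast hn) (by simp)

lemma wp_map_map {d : ℕ} {p : ℝ} (hp : 1 ≤ p) (T : SimpleFunc (Euc d) (Euc d)) :
    ∃ D : ℝ, 0 < D ∧ ∀ P Q : Measure (Euc d), IsProbabilityMeasure P → IsProbabilityMeasure Q →
      WpPow p (P.map T) (Q.map T) ≤
        ENNReal.ofReal D * ∑ y ∈ T.range, (P (T ⁻¹' {y}) - Q (T ⁻¹' {y})) := by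
  refine ⟨1 + ∑ y ∈ T.range, ∑ z ∈ T.range, ‖y - z‖ ^ p, by positivity, fun P Q hP hQ => ?_⟩
  have tot : ∀ P : Measure (Euc d), IsProbabilityMeasure P →
      ∑ y ∈ T.range, P (T ⁻¹' {y}) = 1 := by
    intro P hP
    rw [← discM_univ, ← map_simple, Measure.map_apply T.measurable MeasurableSet.univ]
    simp
  rw [map_simple, map_simple]
  refine wp_disc hp _ _ _ (tot P hP) (tot Q hQ) _ fun y hy z hz => ?_
  apply ENNReal.ofReal_le_ofReal
  have h1 : ‖y - z‖ ^ p ≤ ∑ z ∈ T.range, ‖y - z‖ ^ p :=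
    Finset.single_le_sum (f := fun z => ‖y - z‖ ^ p) (fun _ _ => by positivity) hz
  have h2 : ∑ z ∈ T.range, ‖y - z‖ ^ p ≤ ∑ y ∈ T.range, ∑ z ∈ T.range, ‖y - z‖ ^ p :=
    Finset.single_le_sum (f := fun y => ∑ z ∈ T.range, ‖y - z‖ ^ p)
      (fun _ _ => by positivity) hy
  linarith

lemma markov_emp {d : ℕ} (P : Measure (Euc d)) [IsProbabilityMeasure P] {n : ℕ} (hn : n ≠ 0)
    (f : Euc d → ℝ≥0∞) (hf : Measurable f) (a : ℝ≥0∞) (ha : a ≠ 0) (ha' : a ≠ ∞) :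
    prodn P n {x | a < ∫⁻ y, f y ∂(empDist x)} ≤ (∫⁻ y, f y ∂P) / a := by
  have h1 : ∫⁻ x, (∫⁻ y, f y ∂(empDist x)) ∂(prodn P n) = ∫⁻ y, f y ∂P := by
    simp only [lintegral_emp]
    rw [lintegral_const_mul _ (by fun_prop), lintegral_finsetSum _ (by fun_prop)]
    have : ∀ i : Fin n, ∫⁻ x, f (x i) ∂(prodn P n) = ∫⁻ y, f y ∂P := fun i =>
      (measurePreserving_eval (fun _ : Fin n => P) i).lintegral_comp hf
    simp only [this, Finset.sum_const, Finset.card_univ, Fintype.card_fin, nsmul_eq_mul]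
    rw [← mul_assoc, ENNReal.inv_mul_cancel (by exact_mod_cast hn) (by simp), one_mul]
  rw [← h1]
  refine (measure_mono fun x hx => ?_).trans (meas_ge_le_lintegral_div ?_ ha ha')
  · exact le_of_lt (show a < ∫⁻ y, f y ∂(empDist x) from hx)
  · simp only [lintegral_emp]
    refine Measurable.aemeasurable ?_
    fun_prop

open ProbabilityTheory in
lemma cheb_emp {d : ℕ} (P : Measure (Euc d)) [IsProbabilityMeasure P] {n : ℕ} (hn : n ≠ 0)
    (B : Set (Euc d)) (hB : MeasurableSet B) (δ : ℝ) (hδ : 0 < δ) :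
    prodn P n {x | ENNReal.ofReal δ < empDist x B - P B} ≤ ENNReal.ofReal (1 / (n * δ ^ 2)) := by
  have hn' : (0 : ℝ) < n := by positivity
  set f : Euc d → ℝ := B.indicator 1 with hf
  have fm : Measurable f := measurable_one.indicator hB
  have fb : ∀ x, f x ∈ Set.Icc (0 : ℝ) 1 := fun x => by
    by_cases h : x ∈ B <;> simp [hf, h]
  have fL : MemLp f 2 P := memLp_of_bounded (Eventually.of_forall fb) fm.aestronglyMeasurable _
  have hpr : IsProbabilityMeasure (prodn P n) := by unfold prodn; infer_instance
  set Z : (Fin n → Euc d) → ℝ := ∑ i, fun x => f (x i) with hZ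
  have fi : ∀ i : Fin n, MemLp (fun x : Fin n → Euc d => f (x i)) 2 (prodn P n) := fun i =>
    fL.comp_measurePreserving (measurePreserving_eval (fun _ : Fin n => P) i)
  have ZL : MemLp Z 2 (prodn P n) := memLp_finsetSum' _ fun i _ => fi i
  have vZ : Var[Z; prodn P n] ≤ n := by
    have := variance_sum_pi (μ := fun _ : Fin n => P) (X := fun _ => f) (fun _ => fL)
    rw [show Var[Z; prodn P n] = _ from this]
    have hv : Var[f; P] ≤ 1 := by
      have := variance_le_sq_of_bounded (Eventually.of_forall fb) fm.aemeasurable (μ := P)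
      norm_num at this
      linarith
    calc _ ≤ ∑ i : Fin n, (1 : ℝ) := Finset.sum_le_sum fun i _ => hv
      _ = n := by simp
  have eZ : ∫ x, Z x ∂(prodn P n) = n * P.real B := by
    simp only [hZ, Finset.sum_apply]
    rw [integral_finsetSum _ fun i _ => (fi i).integrable (by norm_num)]
    have : ∀ i : Fin n, ∫ x, f (x i) ∂(prodn P n) = P.real B := fun i => by
      have := integral_comp_eval (μ := fun _ : Fin n => P) (i := i) (f := f)
        fm.aestronglyMeasurable
      rw [show ∫ x, f (x i) ∂(prodn P n) = _ from this, hf, integral_indicator_one hB]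
    simp [this]
  have ch := meas_ge_le_variance_div_sq ZL (c := n * δ) (by positivity)
  refine (measure_mono fun x hx => ?_).trans (ch.trans (ENNReal.ofReal_le_ofReal ?_))
  · have ip := emp_prob hn x
    simp only [Set.mem_ofPred_eq] at hx ⊢
    have e1 : (empDist x B).toReal = (n : ℝ)⁻¹ * Z x := by
      rw [← lintegral_indicator_one hB, lintegral_emp, ENNReal.toReal_mul, ENNReal.toReal_sum]
      · simp only [ENNReal.toReal_inv, ENNReal.toReal_natCast, hZ, Finset.sum_apply, hf]
        congr 1
        refine Finset.sum_congr rfl fun i _ => ?_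
        by_cases h : x i ∈ B <;> simp [h]
      · intro i _
        by_cases h : x i ∈ B <;> simp [h]
    have h2 : P B ≤ empDist x B := by
      by_contra h
      rw [tsub_eq_zero_of_le (le_of_not_ge h)] at hx
      simp at hx
    have h3 := ENNReal.toReal_sub_of_le h2 (measure_ne_top _ _)
    have h4 : δ < (empDist x B - P B).toReal :=
      (ENNReal.ofReal_lt_iff_lt_toReal hδ.le (by finiteness)).1 hx
    rw [eZ]
    refine le_trans ?_ (le_abs_self _)
    rw [h3, e1] at h4
    have h5 : n * δ < n * ((n : ℝ)⁻¹ * Z x - (P B).toReal) := by gcongr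
    rw [mul_sub, mul_inv_cancel_left₀ hn'.ne'] at h5
    exact h5.le
  · rw [div_le_div_iff₀ (by positivity) (by positivity)]
    calc _ ≤ (n : ℝ) * (n * δ ^ 2) := by gcongr
      _ = _ := by ring

lemma tcost_simple_meas {d : ℕ} (p : ℝ) (T : SimpleFunc (Euc d) (Euc d)) :
    Measurable (fun x => tcost p x (T x)) := by
  have h : Measurable (T : Euc d → Euc d) := T.measurable
  unfold tcost
  fun_prop

lemma exists_nearest (d : ℕ) : ∃ T : ℕ → SimpleFunc (Euc d) (Euc d),
    (∀ N M x y, N ≤ M → ‖x - T M x‖ ≤ ‖x - T N y‖) ∧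
    (∀ x, Tendsto (fun N => ‖x - T N x‖) atTop (𝓝 0)) ∧ ∀ N x, ‖x - T N x‖ ≤ ‖x‖ := by
  set e : ℕ → Euc d := fun k => Nat.casesOn k 0 (TopologicalSpace.denseSeq (Euc d)) with he
  have conv : ∀ x y : Euc d, ‖x - y‖ = (edist y x).toReal := fun x y => by
    rw [edist_comm, edist_dist, ENNReal.toReal_ofReal dist_nonneg, dist_eq_norm]
  have key : ∀ (x : Euc d) (k N : ℕ), k ≤ N → ‖x - SimpleFunc.nearestPt e N x‖ ≤ ‖x - e k‖ := by
    intro x k N hk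
    rw [conv, conv]
    exact ENNReal.toReal_mono (edist_ne_top _ _) (SimpleFunc.edist_nearestPt_le e x hk)
  refine ⟨SimpleFunc.nearestPt e, fun N M x y h => ?_, fun x => ?_, fun N x => ?_⟩
  · exact key x (SimpleFunc.nearestPtInd e N y) M ((SimpleFunc.nearestPtInd_le e N y).trans h)
  · have hx : x ∈ closure (Set.range e) := by
      have h1 : Set.range (TopologicalSpace.denseSeq (Euc d)) ⊆ Set.range e := by
        rintro _ ⟨k, rfl⟩
        exact ⟨k + 1, rfl⟩
      exact closure_mono h1 (TopologicalSpace.denseRange_denseSeq (Euc d) x)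
    have := (tendsto_const_nhds (x := x)).sub (SimpleFunc.tendsto_nearestPt hx)
    simpa using this.norm
  · have := key x 0 N (Nat.zero_le _)
    simpa [he] using this

lemma moment_tendsto {d : ℕ} {p : ℝ} (hp : 1 ≤ p) (P : Measure (Euc d)) (hP : HasFinMom p P)
    (T : ℕ → SimpleFunc (Euc d) (Euc d))
    (h2 : ∀ x, Tendsto (fun N => ‖x - T N x‖) atTop (𝓝 0)) (h3 : ∀ N x, ‖x - T N x‖ ≤ ‖x‖) :
    Tendsto (fun N => ∫⁻ x, tcost p x (T N x) ∂P) atTop (𝓝 0) := by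
  have := tendsto_lintegral_of_dominated_convergence (μ := P) (F := fun N x => tcost p x (T N x))
    (f := fun _ => 0) (fun x => ENNReal.ofReal (‖x‖ ^ p)) (fun N => ?_) (fun N => ?_) hP ?_
  · simpa using this
  · exact tcost_simple_meas p (T N)
  · refine Eventually.of_forall fun x => ENNReal.ofReal_le_ofReal ?_
    exact Real.rpow_le_rpow (norm_nonneg _) (h3 N x) (by linarith)
  · refine Eventually.of_forall fun x => ?_
    have h := (h2 x).rpow_const (p := p) (Or.inr (by linarith))
    rw [Real.zero_rpow (by linarith)] at h
    simpa [tcost] using ENNReal.tendsto_ofReal h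

lemma moment_near {d : ℕ} {p : ℝ} (hp : 1 ≤ p) (P Q : Measure (Euc d))
    (T : ℕ → SimpleFunc (Euc d) (Euc d))
    (h1 : ∀ N M x y, N ≤ M → ‖x - T M x‖ ≤ ‖x - T N y‖) (N M : ℕ) (hNM : N ≤ M) :
    ∫⁻ x, tcost p x (T M x) ∂P ≤
      ENNReal.ofReal (2 ^ (p - 1)) * (WpPow p P Q + ∫⁻ x, tcost p x (T N x) ∂Q) := by
  have hC : ENNReal.ofReal (2 ^ (p - 1)) ≠ 0 := by
    simp only [ne_eq, ENNReal.ofReal_eq_zero, not_le]; positivity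
  have tm : ∀ N, Measurable (fun x => tcost p x (T N x)) := fun N =>
    tcost_simple_meas p (T N)
  by_cases ht : WpPow p P Q = ∞
  · rw [ht, top_add, ENNReal.mul_top hC]
    exact le_top
  refine ENNReal.le_of_forall_pos_le_add ?_ |>.trans (le_refl _)
  intro ε hε _
  set C := ENNReal.ofReal (2 ^ (p - 1)) with hCdef
  have hlt : WpPow p P Q < WpPow p P Q + ε / C := by
    refine ENNReal.lt_add_right ht ?_
    refine (ENNReal.div_pos (by exact_mod_cast hε.ne') ENNReal.ofReal_ne_top).ne'
  obtain ⟨γ, hγ, hc⟩ := wp_lt hlt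
  have e1 : ∫⁻ x, tcost p x (T M x) ∂P = ∫⁻ z, tcost p z.1 (T M z.1) ∂γ := by
    rw [← hγ.2.1, lintegral_map (tm M) measurable_fst]
  have e2 : ∫⁻ x, tcost p x (T N x) ∂Q = ∫⁻ z, tcost p z.2 (T N z.2) ∂γ := by
    rw [← hγ.2.2, lintegral_map (tm N) measurable_snd]
  calc ∫⁻ x, tcost p x (T M x) ∂P = ∫⁻ z, tcost p z.1 (T M z.1) ∂γ := e1
    _ ≤ ∫⁻ z, C * (tcost p z.1 z.2 + tcost p z.2 (T N z.2)) ∂γ := by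
      refine lintegral_mono fun z => ?_
      refine le_trans ?_ (tcost_tri hp z.1 z.2 (T N z.2))
      exact ENNReal.ofReal_le_ofReal
        (Real.rpow_le_rpow (norm_nonneg _) (h1 N M z.1 z.2 hNM) (by linarith))
    _ = C * (∫⁻ z, tcost p z.1 z.2 ∂γ + ∫⁻ x, tcost p x (T N x) ∂Q) := by
      have hm : Measurable (fun z : Euc d × Euc d => tcost p z.1 z.2 + tcost p z.2 (T N z.2)) :=
        (tcost_meas p).add ((tm N).comp measurable_snd)
      rw [lintegral_const_mul _ hm,
        lintegral_add_left (tcost_meas p), e2]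
    _ ≤ C * (WpPow p P Q + ε / C + ∫⁻ x, tcost p x (T N x) ∂Q) := by gcongr
    _ = C * (WpPow p P Q + ∫⁻ x, tcost p x (T N x) ∂Q) + C * (ε / C) := by ring
    _ = _ := by rw [ENNReal.mul_div_cancel hC ENNReal.ofReal_ne_top]

lemma wp_of_Wp {d : ℕ} {p : ℝ} (hp : 1 ≤ p) (P Q : Measure (Euc d)) (a : ℝ) (ha : 0 < a)
    (h : Wp p P Q < ENNReal.ofReal (a ^ (1 / p))) : WpPow p P Q < ENNReal.ofReal a := by
  unfold Wp at h
  rw [← ENNReal.ofReal_rpow_of_pos ha] at h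
  exact (ENNReal.rpow_lt_rpow_iff (by positivity)).1 h

/-- Uniform law of large numbers for measures well approximated by a finite set. -/
lemma event_sub {d : ℕ} {p : ℝ} (hp : 1 ≤ p) (T : SimpleFunc (Euc d) (Euc d)) (a : ℝ)
    (ha : 0 < a) : ∃ δ > 0, ∀ (P R : Measure (Euc d)), IsProbabilityMeasure P →
      ∫⁻ x, tcost p x (T x) ∂P ≤ ENNReal.ofReal a → WpPow p P R ≤ ENNReal.ofReal a →
      ∀ n : ℕ, n ≠ 0 → ∀ x : Fin n → Euc d,
      ∫⁻ y, tcost p y (T y) ∂(empDist x) ≤ ENNReal.ofReal a →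
      (∀ y ∈ T.range, empDist x (T ⁻¹' {y}) - P (T ⁻¹' {y}) ≤ ENNReal.ofReal δ) →
      WpPow p (empDist x) R ≤ ENNReal.ofReal (2 ^ (p - 1)) * (ENNReal.ofReal (2 ^ (p - 1)) *
        (ENNReal.ofReal a + ENNReal.ofReal (2 ^ (p - 1)) * (ENNReal.ofReal a + ENNReal.ofReal a))
        + ENNReal.ofReal a) := by
  obtain ⟨D, hD, hW⟩ := wp_map_map hp T
  refine ⟨a / (D * (T.range.card + 1)), by positivity, ?_⟩
  intro P R hP hPa hPR n hn x hx hy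
  have := emp_prob hn x
  refine (wp_tri hp _ P _).trans ?_
  gcongr
  refine (wp_tri hp _ ((empDist x).map T) _).trans ?_
  gcongr
  · exact (wp_map_le p _ T T.measurable).trans hx
  refine (wp_tri hp _ (P.map T) _).trans ?_
  gcongr
  · refine (hW _ _ this hP).trans ?_
    calc _ ≤ ENNReal.ofReal D * ∑ y ∈ T.range, ENNReal.ofReal (a / (D * (T.range.card + 1))) := by
          gcongr with y hy'
          exact hy y hy'
      _ = ENNReal.ofReal (D * (T.range.card * (a / (D * (T.range.card + 1))))) := by
          rw [Finset.sum_const, nsmul_eq_mul, ENNReal.ofReal_mul hD.le,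
            ENNReal.ofReal_mul (Nat.cast_nonneg _), ENNReal.ofReal_natCast]
      _ ≤ ENNReal.ofReal a := by
          apply ENNReal.ofReal_le_ofReal
          have : D * (T.range.card * (a / (D * (T.range.card + 1))))
            = a * (T.range.card / (T.range.card + 1)) := by field_simp
          rw [this]
          refine mul_le_of_le_one_right ha.le ?_
          rw [div_le_one (by positivity)]
          linarith
  · exact (wp_comm_le p _ _).trans ((wp_map_le p P T T.measurable).trans hPa)

/-- Proposition on general parametric families, part (i).  If the parametric
family `θ ↦ P_θ` of probability measures with finite `p`-th moments is one-to-one and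
`W_p`-continuous on the metric space `Θ`, and the measurable estimator `θ̂_n` is weakly
consistent locally uniformly in `θ`, then the test statistic
`T_{M,n} = W_p^p(P̂_n, P_{θ̂_n})` tends to `0` in `P_θⁿ`-probability locally uniformly in
`θ`. -/
theorem parametric_statistic_tendsto_zero_loc_unif {d : ℕ} (p : ℝ) (hp : 1 ≤ p)
    {Θ : Type*} [MetricSpace Θ] [MeasurableSpace Θ] [BorelSpace Θ]
    (Pfam : Θ → Measure (Euc d))
    (hprob : ∀ θ, IsProbabilityMeasure (Pfam θ))
    (hmom : ∀ θ, HasFinMom p (Pfam θ))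
    -- (a) one-to-one and `W_p`-continuous
    (hinj : Function.Injective Pfam)
    (hcont : ∀ θ₀ : Θ, ∀ ε > (0 : ℝ), ∃ δ > (0 : ℝ), ∀ θ : Θ,
      dist θ θ₀ < δ → Wp p (Pfam θ) (Pfam θ₀) < ENNReal.ofReal ε)
    -- measurable estimator
    (est : (n : ℕ) → (Fin n → Euc d) → Θ)
    (hmeas : ∀ n, Measurable (est n))
    -- (b) weak consistency locally uniformly in `θ`
    (hcons : ∀ ε > (0 : ℝ), ∀ K : Set Θ, IsCompact K →
      Tendsto (fun n : ℕ => ⨆ θ ∈ K, prodn (Pfam θ) n {x | ε < dist (est n x) θ})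
        atTop (𝓝 0)) :
    ∀ ε > (0 : ℝ), ∀ K : Set Θ, IsCompact K →
      Tendsto (fun n : ℕ =>
          ⨆ θ ∈ K, prodn (Pfam θ) n
            {x | ENNReal.ofReal ε < WpPow p (empDist x) (Pfam (est n x))})
        atTop (𝓝 0) := by

  intro ε hε K hK
  obtain ⟨T, T1, T2, T3⟩ := exists_nearest d
  set C : ℝ := 2 ^ (p - 1) with hC
  have hC0 : 0 < C := by positivity
  -- uniform modulus of continuity
  have modulus : ∀ a > (0 : ℝ), ∃ δ > (0 : ℝ), ∀ θ ∈ K, ∀ θ', dist θ' θ < δ →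
      WpPow p (Pfam θ) (Pfam θ') ≤ ENNReal.ofReal a := by
    intro a ha
    have hb : 0 < (a / (2 * C)) := by positivity
    choose δ hδ hc using fun θ₀ => hcont θ₀ ((a / (2 * C)) ^ (1 / p)) (by positivity)
    obtain ⟨η, hη, hL⟩ := lebesgue_number_lemma_of_metric (c := fun θ₀ => Metric.ball θ₀ (δ θ₀)) hK
      (fun _ => Metric.isOpen_ball)
      (fun θ _ => Set.mem_iUnion.2 ⟨θ, Metric.mem_ball_self (hδ θ)⟩)
    refine ⟨η, hη, fun θ hθ θ' hd => ?_⟩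
    obtain ⟨θ₀, h0⟩ := hL θ hθ
    have c1 := wp_of_Wp hp _ _ _ hb (hc θ₀ θ (h0 (Metric.mem_ball_self hη)))
    have c2 := wp_of_Wp hp _ _ _ hb (hc θ₀ θ' (h0 hd))
    calc WpPow p (Pfam θ) (Pfam θ') ≤ ENNReal.ofReal C *
          (WpPow p (Pfam θ) (Pfam θ₀) + WpPow p (Pfam θ₀) (Pfam θ')) := wp_tri hp _ _ _
      _ ≤ ENNReal.ofReal C * (ENNReal.ofReal (a / (2 * C)) + ENNReal.ofReal (a / (2 * C))) := by
          gcongr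
          exact (wp_comm_le p _ _).trans c2.le
      _ = ENNReal.ofReal a := by
          rw [← ENNReal.ofReal_add hb.le hb.le, ← ENNReal.ofReal_mul hC0.le]
          congr 1
          field_simp
          ring
  -- uniform approximation
  have approx : ∀ a > (0 : ℝ), ∃ N, ∀ θ ∈ K, ∫⁻ x, tcost p x (T N x) ∂(Pfam θ) ≤
      ENNReal.ofReal a := by
    intro a ha
    have hb : 0 < (a / (2 * C)) := by positivity
    obtain ⟨η, hη, hm⟩ := modulus (a / (2 * C)) hb
    have hN : ∀ θ, ∃ N, ∫⁻ x, tcost p x (T N x) ∂(Pfam θ) ≤ ENNReal.ofReal (a / (2 * C)) := by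
      intro θ
      have := moment_tendsto hp (Pfam θ) (hmom θ) T T2 T3
      exact (this.eventually_le_const (ENNReal.ofReal_pos.2 hb)).exists
    choose N hN using hN
    obtain ⟨t, ht⟩ := hK.elim_finite_subcover (fun θ => Metric.ball θ η)
      (fun _ => Metric.isOpen_ball)
      (fun θ _ => Set.mem_iUnion.2 ⟨θ, Metric.mem_ball_self hη⟩)
    refine ⟨t.sup N, fun θ hθ => ?_⟩
    obtain ⟨θ₀, h0⟩ := Set.mem_iUnion.1 (ht hθ)
    obtain ⟨h0t, h0b⟩ := Set.mem_iUnion.1 h0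
    calc _ ≤ ENNReal.ofReal C * (WpPow p (Pfam θ) (Pfam θ₀) +
          ∫⁻ x, tcost p x (T (N θ₀) x) ∂(Pfam θ₀)) :=
            moment_near hp _ _ T T1 _ _ (Finset.le_sup h0t)
      _ ≤ ENNReal.ofReal C * (ENNReal.ofReal (a / (2 * C)) + ENNReal.ofReal (a / (2 * C))) := by
          gcongr
          · exact hm θ hθ θ₀ (by rw [dist_comm]; exact h0b)
          · exact hN θ₀
      _ = ENNReal.ofReal a := by
          rw [← ENNReal.ofReal_add hb.le hb.le, ← ENNReal.ofReal_mul hC0.le]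
          congr 1
          field_simp
          ring
  set a : ℝ := ε / (C * (C * (1 + C * 2) + 1)) with ha_def
  have ha : 0 < a := by positivity
  obtain ⟨η, hη, hmod⟩ := modulus a ha
  refine ENNReal.tendsto_nhds_zero.2 fun r hr => ?_
  obtain ⟨r', hr', hrr⟩ : ∃ r' : ℝ, 0 < r' ∧ ENNReal.ofReal r' ≤ r := by
    obtain ⟨q, hq, hq'⟩ := ENNReal.lt_iff_exists_nnreal_btwn.1 hr
    exact ⟨q, by exact_mod_cast hq, by simpa using hq'.le⟩
  obtain ⟨N, hN⟩ := approx (min a (a * (r' / 3))) (by positivity)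
  obtain ⟨δ, hδ, hev⟩ := event_sub hp (T N) a ha
  have E1 := (hcons (η / 2) (by positivity) K hK).eventually_le_const
    (ENNReal.ofReal_pos.2 (show 0 < r' / 3 by positivity))
  have E2 : ∀ᶠ n : ℕ in atTop, ((T N).range.card : ℝ) * (1 / (n * δ ^ 2)) ≤ r' / 3 := by
    have : Tendsto (fun n : ℕ => ((T N).range.card : ℝ) * (1 / (n * δ ^ 2))) atTop (𝓝 0) := by
      have h := (tendsto_one_div_atTop_nhds_zero_nat (𝕜 := ℝ)).const_mul
        (((T N).range.card : ℝ) * (1 / δ ^ 2))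
      rw [mul_zero] at h
      refine h.congr fun n => ?_
      rw [mul_assoc, one_div_mul_one_div, mul_comm (δ ^ 2)]
    exact this.eventually_le_const (by positivity)
  filter_upwards [E1, E2, eventually_ge_atTop 1] with n e1 e2 hn1
  have hn : n ≠ 0 := by omega
  refine iSup₂_le fun θ hθ => le_trans ?_ hrr
  have iP := hprob θ
  have sub : {x : Fin n → Euc d | ENNReal.ofReal ε < WpPow p (empDist x) (Pfam (est n x))} ⊆
      {x | η / 2 < dist (est n x) θ} ∪
      ({x | ENNReal.ofReal a < ∫⁻ y, tcost p y (T N y) ∂(empDist x)} ∪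
      ⋃ y ∈ (T N).range,
        {x | ENNReal.ofReal δ < empDist x (T N ⁻¹' {y}) - Pfam θ (T N ⁻¹' {y})}) := by
    intro x hx
    by_contra hcon
    simp only [Set.mem_union, Set.mem_iUnion, Set.mem_ofPred_eq, not_or, not_exists, not_lt]
      at hcon
    obtain ⟨g1, g2, g3⟩ := hcon
    have := hev (Pfam θ) (Pfam (est n x)) iP
      ((hN θ hθ).trans (ENNReal.ofReal_le_ofReal (min_le_left _ _)))
      (hmod θ hθ _ (by linarith)) n hn x g2 g3
    refine absurd this (not_le.2 (lt_of_le_of_lt ?_ hx))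
    rw [← ENNReal.ofReal_add ha.le ha.le, ← ENNReal.ofReal_mul hC0.le,
      ← ENNReal.ofReal_add ha.le (by positivity), ← ENNReal.ofReal_mul hC0.le,
      ← ENNReal.ofReal_add (by positivity) ha.le, ← ENNReal.ofReal_mul hC0.le]
    apply ENNReal.ofReal_le_ofReal
    apply le_of_eq
    rw [show C * (C * (a + C * (a + a)) + a) = a * (C * (C * (1 + C * 2) + 1)) by ring, ha_def]
    field_simp
  have B1 : prodn (Pfam θ) n {x | η / 2 < dist (est n x) θ} ≤ ENNReal.ofReal (r' / 3) :=
    (le_iSup₂ (f := fun θ (_ : θ ∈ K) => prodn (Pfam θ) n {x | η / 2 < dist (est n x) θ})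
      θ hθ).trans e1
  have B2 : prodn (Pfam θ) n {x | ENNReal.ofReal a < ∫⁻ y, tcost p y (T N y) ∂(empDist x)} ≤
      ENNReal.ofReal (r' / 3) := by
    refine (markov_emp (Pfam θ) hn (fun y => tcost p y (T N y))
      (tcost_simple_meas p (T N)) _
      (ENNReal.ofReal_pos.2 ha).ne' ENNReal.ofReal_ne_top).trans ?_
    refine ENNReal.div_le_of_le_mul ?_
    rw [← ENNReal.ofReal_mul (by positivity), mul_comm]
    exact (hN θ hθ).trans (ENNReal.ofReal_le_ofReal (min_le_right _ _))
  have B3 : prodn (Pfam θ) n (⋃ y ∈ (T N).range,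
      {x | ENNReal.ofReal δ < empDist x (T N ⁻¹' {y}) - Pfam θ (T N ⁻¹' {y})}) ≤
      ENNReal.ofReal (r' / 3) := by
    refine (measure_biUnion_finset_le _ _).trans ?_
    refine (Finset.sum_le_sum fun y _ =>
      cheb_emp (Pfam θ) hn _ ((T N).measurableSet_preimage {y}) δ hδ).trans ?_
    rw [Finset.sum_const, nsmul_eq_mul, ← ENNReal.ofReal_natCast,
      ← ENNReal.ofReal_mul (Nat.cast_nonneg _)]
    exact ENNReal.ofReal_le_ofReal e2
  calc _ ≤ _ := measure_mono sub
    _ ≤ _ := measure_union_le _ _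
    _ ≤ _ := add_le_add B1 ((measure_union_le _ _).trans (add_le_add B2 B3))
    _ = ENNReal.ofReal r' := by
      rw [← ENNReal.ofReal_add (by positivity) (by positivity),
        ← ENNReal.ofReal_add (by positivity) (by positivity)]
      congr 1
      ring
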